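/- For every positive integer d with d ≡ 3 (mod 4), the trace of singular moduli t(d) satisfies −exp(π√d) − (1/2)(2πd)^{3/2} exp((π/3)√d) ≤ t(d) ≤ (1/2)(2πd)^{3/2} exp((π/3)√d) − exp(π√d). -/

import Mathlib

noncomputable section

/-- The weight `k` lattice Eisenstein sum `∑_{(c,d) ≠ (0,0)} 1/(cτ+d)^k`. -/
noncomputable def latticeG (k : ℕ) (τ : ℂ) : ℂ :=
  ∑' p : ℤ × ℤ, if p = 0 then 0 else 1 / ((p.1 : ℂ) * τ + (p.2 : ℂ)) ^ k

/-- The modular `j`-invariant `j = 1728 E₄³/(E₄³ - E₆²) = 1728 g₂³/(g₂³ - 27 g₃²)`. -/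
noncomputable def jInv (τ : ℂ) : ℂ :=
  1728 * (60 * latticeG 4 τ) ^ 3 /
    ((60 * latticeG 4 τ) ^ 3 - 27 * (140 * latticeG 6 τ) ^ 2)

/-- The value of the binary quadratic form `aX² + bXY + cY²` (encoded `(a, b, c)`) at `(x, y)`. -/
def formVal (f : ℤ × ℤ × ℤ) (x y : ℤ) : ℤ :=
  f.1 * x ^ 2 + f.2.1 * x * y + f.2.2 * y ^ 2

/-- `f` is a positive definite integral binary quadratic form of discriminant `-d`. -/
def IsForm (d : ℤ) (f : ℤ × ℤ × ℤ) : Prop :=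
  0 < f.1 ∧ f.2.1 ^ 2 - 4 * f.1 * f.2.2 = -d

/-- Two forms are `SL₂(ℤ)`-equivalent. -/
def FormRel (f f' : ℤ × ℤ × ℤ) : Prop :=
  ∃ g : Matrix.SpecialLinearGroup (Fin 2) ℤ,
    ∀ x y : ℤ,
      formVal f' x y =
        formVal f (g.1 0 0 * x + g.1 0 1 * y) (g.1 1 0 * x + g.1 1 1 * y)

/-- The set of `SL₂(ℤ)`-classes of positive definite forms of discriminant `-d`. -/
abbrev FormClass (d : ℤ) :=
  Quot (fun f f' : { f : ℤ × ℤ × ℤ // IsForm d f } => FormRel f.1 f'.1)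

/-- The root `α_Q = (-b + i√d)/(2a)` in the upper half plane of `Q(X,1) = 0`. -/
noncomputable def formRoot (f : ℤ × ℤ × ℤ) : ℂ :=
  (-(f.2.1 : ℂ) + Complex.I * ((Real.sqrt ((4 * f.1 * f.2.2 - f.2.1 ^ 2 : ℤ) : ℝ) : ℝ) : ℂ)) /
    (2 * (f.1 : ℂ))

/-- `w_Q`: the order of the stabilizer of the form `f` in `PSL₂(ℤ)`, i.e. half the order of
its stabilizer in `SL₂(ℤ)` (the stabilizer always contains `±1`). -/
noncomputable def formWt (f : ℤ × ℤ × ℤ) : ℕ :=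
  Nat.card { g : Matrix.SpecialLinearGroup (Fin 2) ℤ //
    ∀ x y : ℤ,
      formVal f x y =
        formVal f (g.1 0 0 * x + g.1 0 1 * y) (g.1 1 0 * x + g.1 1 1 * y) } / 2

/-- The trace of singular moduli `t(d) = ∑_{Q ∈ Q_d/Γ} (j(α_Q) - 744)/w_Q`, with the
conventions `t(0) = 2`, `t(-1) = -1` and `t(d) = 0` for `d < -1` or `d ≡ 1, 2 (mod 4)`. -/
noncomputable def traceSM (d : ℤ) : ℝ :=
  if d = 0 then 2
  else if d = -1 then -1
  else if d < -1 ∨ d % 4 = 1 ∨ d % 4 = 2 then 0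
  else (∑ᶠ cl : FormClass d,
    (jInv (formRoot (Quot.out cl).1) - 744) / (formWt (Quot.out cl).1 : ℂ)).re

end

open scoped ArithmeticFunction.sigma in
lemma exists_sigma_series_remainder (k : ℕ) (C : ℝ) (hC : ∀ n : ℕ, (σ k (n + 4) : ℝ) ≤ C * 4 ^ n)
    (q : ℂ) (hq : ‖q‖ ≤ 1 / 225) :
    ∃ r : ℂ, ‖r‖ ≤ C * (225 / 221) ∧ ∑' n : ℕ+, (σ k n : ℂ) * q ^ (n : ℕ) =
      σ k 1 * q + σ k 2 * q ^ 2 + σ k 3 * q ^ 3 + q ^ 4 * r := by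
  have hb : ∀ n : ℕ, ‖(σ k (n + 4) : ℂ) * q ^ n‖ ≤ C * (4 / 225) ^ n := by
    intro n
    rw [norm_mul, norm_pow, Complex.norm_natCast]
    calc (σ k (n + 4) : ℝ) * ‖q‖ ^ n ≤ (C * 4 ^ n) * (1 / 225) ^ n := by
          exact mul_le_mul (hC n) (by gcongr) (by positivity) ((Nat.cast_nonneg _).trans (hC n))
      _ = C * (4 / 225) ^ n := by
          rw [mul_assoc, ← mul_pow]; norm_num
  have hg : HasSum (fun n : ℕ => C * (4 / 225 : ℝ) ^ n) (C * (225 / 221)) := by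
    have := (hasSum_geometric_of_lt_one (r := (4 / 225 : ℝ)) (by norm_num) (by norm_num)).mul_left C
    norm_num at this ⊢
    exact this
  have hs : Summable fun n : ℕ => (σ k (n + 4) : ℂ) * q ^ n := .of_norm_bounded hg.summable hb
  refine ⟨∑' n : ℕ, (σ k (n + 4) : ℂ) * q ^ n, tsum_of_norm_bounded hg hb, ?_⟩
  have hs4 : Summable fun n : ℕ => (σ k (n + 4) : ℂ) * q ^ (n + 4) := by
    refine (hs.mul_left (q ^ 4)).congr fun n => ?_
    ring
  have hs1 : Summable fun n : ℕ => (σ k (n + 1) : ℂ) * q ^ (n + 1) :=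
    (summable_nat_add_iff 3 (f := fun n : ℕ => (σ k (n + 1) : ℂ) * q ^ (n + 1))).mp hs4
  rw [tsum_pnat_eq_tsum_succ (f := fun n : ℕ => (σ k n : ℂ) * q ^ n),
    ← hs1.sum_add_tsum_nat_add 3, ← tsum_mul_left]
  simp only [Finset.sum_range_succ, Finset.sum_range_zero]
  congr 1
  · ring
  · exact tsum_congr fun n => by ring

lemma sigma_three_le (n : ℕ) :
    (ArithmeticFunction.sigma 3 (n + 4) : ℝ) ≤ 256 * 4 ^ n := by
  have h : (n + 4) ^ 4 ≤ 256 * 4 ^ n := by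
    induction n with
    | zero => norm_num
    | succ n ih =>
      have : (n + 1 + 4) ^ 4 ≤ 4 * (n + 4) ^ 4 := by
        ring_nf; gcongr <;> omega
      rw [pow_succ 4]; linarith
  exact_mod_cast (ArithmeticFunction.sigma_le_pow_succ 3 (n + 4)).trans h

lemma sigma_five_le (n : ℕ) :
    (ArithmeticFunction.sigma 5 (n + 4) : ℝ) ≤ 4096 * 4 ^ n := by
  have h : (n + 4) ^ 6 ≤ 4096 * 4 ^ n := by
    induction n with
    | zero => norm_num
    | succ n ih =>
      have : (n + 1 + 4) ^ 6 ≤ 4 * (n + 4) ^ 6 := by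
        ring_nf; gcongr <;> omega
      rw [pow_succ 4]; linarith
  exact_mod_cast (ArithmeticFunction.sigma_le_pow_succ 5 (n + 4)).trans h

open scoped ArithmeticFunction.sigma Nat in
lemma latticeG_eq {k : ℕ} (hk : 3 ≤ k) (hk2 : Even k) (z : UpperHalfPlane) :
    latticeG k z = 2 * riemannZeta k + 2 * ((-2 * Real.pi * Complex.I) ^ k / (k - 1)!) *
      ∑' n : ℕ+, σ (k - 1) n * Complex.exp (2 * Real.pi * Complex.I * z) ^ (n : ℕ) := by
  rw [← tsum_eisSummand_eq_tsum_sigma_mul_cexp_pow hk hk2 z, latticeG,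
    ← (finTwoArrowEquiv ℤ).symm.tsum_eq]
  refine tsum_congr fun p => ?_
  split_ifs with hp
  · subst hp
    simp [EisensteinSeries.eisSummand, show k ≠ 0 by omega]
  · simp [EisensteinSeries.eisSummand]

lemma riemannZeta_six : riemannZeta 6 = Real.pi ^ 6 / 945 := by
  have h := riemannZeta_two_mul_nat (k := 3) (by norm_num)
  have hb : bernoulli 6 = 1 / 42 := by
    rw [bernoulli_eq_bernoulli'_of_ne_one (by norm_num)]
    simp [bernoulli'_def 6, Finset.sum_range_succ, Nat.choose, bernoulli'_def 5]
    norm_num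
  norm_num [hb, Nat.factorial] at h
  rw [h]
  ring

/-- The Eisenstein lattice sum of weight four, expanded to third order in `q`. -/
lemma latticeG_four_expansion (z : UpperHalfPlane)
    (hq : ‖Complex.exp (2 * Real.pi * Complex.I * z)‖ ≤ 1 / 225) :
    ∃ r : ℂ, ‖r‖ ≤ 261 ∧ ∀ q, q = Complex.exp (2 * Real.pi * Complex.I * z) →
      60 * latticeG 4 z = 4 * Real.pi ^ 4 / 3 *
        (1 + 240 * q + 2160 * q ^ 2 + 6720 * q ^ 3 + 240 * q ^ 4 * r) := by
  obtain ⟨r, hr, h⟩ := exists_sigma_series_remainder 3 256 sigma_three_le _ hq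
  refine ⟨r, hr.trans (by norm_num), ?_⟩
  rintro q rfl
  have h2 : ArithmeticFunction.sigma 3 2 = 9 := by decide
  have h3 : ArithmeticFunction.sigma 3 3 = 28 := by decide
  have e := latticeG_eq (k := 4) (by norm_num) (by decide) z
  have hI : (-2 * Real.pi * Complex.I) ^ 4 = 16 * Real.pi ^ 4 := by
    rw [mul_pow, Complex.I_pow_four]; ring
  rw [show 4 - 1 = 3 from rfl, h, hI, h2, h3, ArithmeticFunction.sigma_one,
    show ((4 : ℕ) : ℂ) = 4 by norm_num, riemannZeta_four] at e
  rw [e]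
  norm_num [Nat.factorial]
  ring

/-- The Eisenstein lattice sum of weight six, expanded to third order in `q`. -/
lemma latticeG_six_expansion (z : UpperHalfPlane)
    (hq : ‖Complex.exp (2 * Real.pi * Complex.I * z)‖ ≤ 1 / 225) :
    ∃ r : ℂ, ‖r‖ ≤ 4171 ∧ ∀ q, q = Complex.exp (2 * Real.pi * Complex.I * z) →
      140 * latticeG 6 z = 8 * Real.pi ^ 6 / 27 *
        (1 - 504 * q - 16632 * q ^ 2 - 122976 * q ^ 3 - 504 * q ^ 4 * r) := by
  obtain ⟨r, hr, h⟩ := exists_sigma_series_remainder 5 4096 sigma_five_le _ hq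
  refine ⟨r, hr.trans (by norm_num), ?_⟩
  rintro q rfl
  have h2 : ArithmeticFunction.sigma 5 2 = 33 := by decide
  have h3 : ArithmeticFunction.sigma 5 3 = 244 := by decide
  have e := latticeG_eq (k := 6) (by norm_num) (by decide) z
  have hI : (-2 * Real.pi * Complex.I) ^ 6 = -64 * Real.pi ^ 6 := by
    rw [mul_pow, show Complex.I ^ 6 = -1 by rw [Complex.I_pow_eq_pow_mod]; simp]; ring
  rw [show 6 - 1 = 5 from rfl, h, hI, h2, h3, ArithmeticFunction.sigma_one,
    show ((6 : ℕ) : ℂ) = 6 by norm_num, riemannZeta_six] at e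
  rw [e]
  norm_num [Nat.factorial]
  ring

lemma norm_add_mul_le {a b q : ℂ} {x A B : ℝ} (ha : ‖a‖ ≤ A) (hb : ‖b‖ ≤ B) (hq : ‖q‖ ≤ x) :
    ‖a + q * b‖ ≤ A + x * B := by
  refine (norm_add_le _ _).trans ?_
  rw [norm_mul]
  have : 0 ≤ x := (norm_nonneg q).trans hq
  gcongr

lemma norm_j_remainder_le (q r s : ℂ) (hq0 : q ≠ 0) (hq : ‖q‖ ≤ 1 / 225) (hr : ‖r‖ ≤ 261)
    (hs : ‖s‖ ≤ 4171) (e₄ e₆ : ℂ)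
    (h₄ : e₄ = 1 + 240 * q + 2160 * q ^ 2 + 6720 * q ^ 3 + 240 * q ^ 4 * r)
    (h₆ : e₆ = 1 - 504 * q - 16632 * q ^ 2 - 122976 * q ^ 3 - 504 * q ^ 4 * s) :
    ‖1728 * e₄ ^ 3 / (e₄ ^ 3 - e₆ ^ 2) - 744 - 1 / q‖ ≤ 1500 := by
  have horner {a b : ℂ} {A B : ℝ} (ha : ‖a‖ ≤ A) (hb : ‖b‖ ≤ B) :
      ‖a + q * b‖ ≤ A + 1 / 225 * B := norm_add_mul_le ha hb hq
  have hn (n : ℕ) [n.AtLeastTwo] : ‖(ofNat(n) : ℂ)‖ ≤ (ofNat(n) : ℝ) := (Complex.norm_ofNat n).le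
  have hm (n : ℕ) [n.AtLeastTwo] : ‖(-ofNat(n) : ℂ)‖ ≤ (ofNat(n) : ℝ) := by
    rw [norm_neg]; exact hn n
  have h1 : ‖(1 : ℂ)‖ ≤ (1 : ℝ) := by simp
  have hm1 : ‖(-1 : ℂ)‖ ≤ (1 : ℝ) := by simp
  have h0 : ‖(0 : ℂ)‖ ≤ (0 : ℝ) := by simp
  obtain ⟨a, ha⟩ : ∃ a : ℂ, a = 1 + q * (240 + q * (2160 + q * 6720)) := ⟨_, rfl⟩
  obtain ⟨b, hb⟩ : ∃ b : ℂ, b = 1 + q * (-504 + q * (-16632 + q * -122976)) := ⟨_, rfl⟩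
  have na : ‖a‖ ≤ 2.12 := by
    rw [ha]
    exact (horner h1 (horner (hn 240) (horner (hn 2160) (hn 6720)))).trans (by norm_num)
  have nb : ‖b‖ ≤ 3.58 := by
    rw [hb]
    exact (horner h1 (horner (hm 504) (horner (hm 16632) (hm 122976)))).trans (by norm_num)
  have nr : ‖240 * r‖ ≤ 62640 := by
    rw [norm_mul, Complex.norm_ofNat]; linarith
  have ns : ‖-504 * s‖ ≤ 2102184 := by
    rw [norm_mul, norm_neg, Complex.norm_ofNat]; linarith
  have h₄' : e₄ = a + q * (0 + q * (0 + q * (0 + q * (240 * r)))) := by rw [h₄, ha]; ring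
  have h₆' : e₆ = b + q * (0 + q * (0 + q * (0 + q * (-504 * s)))) := by rw [h₆, hb]; ring
  have n₄ : ‖e₄‖ ≤ 2.13 := by
    rw [h₄']
    exact (horner na (horner h0 (horner h0 (horner h0 nr)))).trans (by norm_num)
  have n₆ : ‖e₆‖ ≤ 3.6 := by
    rw [h₆']
    exact (horner nb (horner h0 (horner h0 (horner h0 ns)))).trans (by norm_num)
  obtain ⟨u, hu⟩ : ∃ u : ℂ, u = 240 * r * (e₄ ^ 2 + e₄ * a + a ^ 2) := ⟨_, rfl⟩
  obtain ⟨v, hv⟩ : ∃ v : ℂ, v = -504 * s * (e₆ + b) := ⟨_, rfl⟩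
  have nu : ‖u‖ ≤ 860000 := by
    have h : ‖e₄ ^ 2 + e₄ * a + a ^ 2‖ ≤ 2.13 ^ 2 + 2.13 * 2.12 + 2.12 ^ 2 := by
      refine (norm_add₃_le ..).trans ?_
      rw [norm_mul, norm_pow, norm_pow]
      gcongr
    rw [hu, norm_mul]
    calc _ ≤ 62640 * (2.13 ^ 2 + 2.13 * 2.12 + 2.12 ^ 2 : ℝ) := by gcongr
      _ ≤ _ := by norm_num
  have nv : ‖v‖ ≤ 15200000 := by
    have h : ‖e₆ + b‖ ≤ 3.6 + 3.58 := (norm_add_le _ _).trans (by gcongr)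
    rw [hv, norm_mul]
    calc _ ≤ 2102184 * (3.6 + 3.58 : ℝ) := by gcongr
      _ ≤ _ := by norm_num
  have hcube : e₄ ^ 3 = a ^ 3 + q ^ 4 * u := by rw [hu, h₄']; ring
  have hsq : e₆ ^ 2 = b ^ 2 + q ^ 4 * v := by rw [hv, h₆']; ring
  obtain ⟨m, hmdef⟩ : ∃ m : ℂ, m = 340215552 + q * ((28977162048 + q * (688087913472 +
      q * (7561287816192 + q * (41742229561344 + q * (124254756864000 + q * (287640944640000 +
      q * 298609016832000)))))) + ((-1 + q * 984) * u + (1 + q * 744) * v)) := ⟨_, rfl⟩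
  obtain ⟨f, hf⟩ : ∃ f : ℂ, f = -41472 + q * (435456 + q * ((-3661632 + q * (516865536 +
      q * (15991962624 + q * (126572544000 + q * (292626432000 + q * 303464448000))))) +
      (u - v))) := ⟨_, rfl⟩
  have nuv : ‖u - v‖ ≤ 16060000 := (norm_sub_le _ _).trans (by linarith)
  have nm : ‖m‖ ≤ 484500000 := by
    have h984 : ‖-1 + q * 984‖ ≤ 5.4 := (horner hm1 (hn 984)).trans (by norm_num)
    have h744 : ‖1 + q * 744‖ ≤ 4.4 := (horner h1 (hn 744)).trans (by norm_num)
    have h : ‖(-1 + q * 984) * u + (1 + q * 744) * v‖ ≤ 5.4 * 860000 + 4.4 * 15200000 := by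
      refine (norm_add_le _ _).trans ?_
      rw [norm_mul, norm_mul]
      gcongr
    rw [hmdef]
    refine (horner (hn _) ((norm_add_le _ _).trans (add_le_add
      (horner (hn _) (horner (hn _) (horner (hn _) (horner (hn _) (horner (hn _)
        (horner (hn _) (hn _))))))) h))).trans ?_
    norm_num
  have nf : ‖f‖ ≤ 44500 := by
    rw [hf]
    refine (horner (hm _) (horner (hn _) ((norm_add_le _ _).trans (add_le_add
      (horner (hm _) (horner (hn _) (horner (hn _) (horner (hn _) (horner (hn _)
        (hn _)))))) nuv)))).trans ?_
    norm_num
  have nden : 1530 ≤ ‖1728 + q * f‖ := by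
    have h : ‖q * f‖ ≤ 1 / 225 * 44500 := by rw [norm_mul]; gcongr
    have h' := norm_sub_le (1728 + q * f) (q * f)
    rw [add_sub_cancel_right, Complex.norm_ofNat] at h'
    linarith
  have hden : 1728 + q * f ≠ 0 := by
    rw [← norm_pos_iff]; linarith
  have hD : e₄ ^ 3 - e₆ ^ 2 = q * (1728 + q * f) := by
    rw [hcube, hsq, hf, ha, hb]; ring
  have hN : 1728 * e₄ ^ 3 * q - (744 * q + 1) * (e₄ ^ 3 - e₆ ^ 2) = q ^ 3 * m := by
    rw [hcube, hsq, hmdef, ha, hb]; ring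
  have key : 1728 * e₄ ^ 3 / (e₄ ^ 3 - e₆ ^ 2) - 744 - 1 / q = q * m / (1728 + q * f) := by
    rw [hD] at hN ⊢
    field_simp
    apply mul_left_cancel₀ hq0
    linear_combination hN
  rw [key, norm_div, norm_mul, div_le_iff₀ (by linarith)]
  calc ‖q‖ * ‖m‖ ≤ 1 / 225 * 484500000 := by gcongr
    _ ≤ 1500 * 1530 := by norm_num
    _ ≤ _ := by gcongr

lemma jInv_eq_of_lattice {τ x y e₄ e₆ : ℂ} (hx : x ^ 3 = 27 * y ^ 2) (hx0 : x ≠ 0)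
    (h₄ : 60 * latticeG 4 τ = x * e₄) (h₆ : 140 * latticeG 6 τ = y * e₆) :
    jInv τ = 1728 * e₄ ^ 3 / (e₄ ^ 3 - e₆ ^ 2) := by
  rw [jInv, h₄, h₆, mul_pow, mul_pow, ← mul_assoc 27, ← hx, ← mul_sub, mul_left_comm,
    mul_div_mul_left _ _ (pow_ne_zero 3 hx0)]

lemma norm_qParam (z : ℂ) :
    ‖Complex.exp (2 * Real.pi * Complex.I * z)‖ = Real.exp (-(2 * Real.pi * z.im)) := by
  rw [Complex.norm_exp]
  congr 1
  simp

lemma exp_neg_le_of_sqrt_three_le {y : ℝ} (hy : Real.sqrt 3 / 2 ≤ y) :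
    Real.exp (-(2 * Real.pi * y)) ≤ 1 / 225 := by
  have h3 : 1.732 ≤ Real.sqrt 3 := Real.le_sqrt_of_sq_le (by norm_num)
  have hπ := Real.pi_gt_d4
  have hle : 5.43 ≤ 2 * Real.pi * y := by nlinarith
  have h1 := Real.exp_one_gt_d9
  have h2 : (225 : ℝ) ≤ Real.exp 5.43 := by
    have e : Real.exp 5.43 = Real.exp 1 ^ 5 * Real.exp 0.43 := by
      rw [← Real.exp_nat_mul, ← Real.exp_add]; norm_num
    have h4 := Real.quadratic_le_exp_of_nonneg (x := 0.43) (by norm_num)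
    have h5 : (2.718 : ℝ) ^ 5 ≤ Real.exp 1 ^ 5 := by gcongr; linarith
    rw [e]
    calc (225 : ℝ) ≤ 2.718 ^ 5 * (1 + 0.43 + 0.43 ^ 2 / 2) := by norm_num
      _ ≤ _ := by gcongr
  rw [Real.exp_neg, one_div]
  exact inv_anti₀ (by norm_num) (h2.trans (Real.exp_le_exp.mpr hle))

/-- In the region `Im τ ≥ √3/2` the `j`-invariant is close to `1/q + 744`. -/
lemma norm_jInv_sub_le {τ : ℂ} (hτ : Real.sqrt 3 / 2 ≤ τ.im) :
    ‖jInv τ - 744 - 1 / Complex.exp (2 * Real.pi * Complex.I * τ)‖ ≤ 1500 := by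
  have hpos : 0 < τ.im := lt_of_lt_of_le (by positivity) hτ
  have hq : ‖Complex.exp (2 * Real.pi * Complex.I * τ)‖ ≤ 1 / 225 := by
    rw [norm_qParam]; exact exp_neg_le_of_sqrt_three_le hτ
  obtain ⟨r, hr, h₄⟩ := latticeG_four_expansion ⟨τ, hpos⟩ hq
  obtain ⟨s, hs, h₆⟩ := latticeG_six_expansion ⟨τ, hpos⟩ hq
  rw [jInv_eq_of_lattice (by ring) (by simp [Real.pi_ne_zero]) (h₄ _ rfl) (h₆ _ rfl)]
  exact norm_j_remainder_le _ r s (Complex.exp_ne_zero _) hq hr hs _ _ rfl rfl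

lemma formRoot_im {d : ℤ} {f : ℤ × ℤ × ℤ} (hf : IsForm d f) :
    (formRoot f).im = Real.sqrt d / (2 * f.1) := by
  have h : 4 * f.1 * f.2.2 - f.2.1 ^ 2 = d := by linarith [hf.2]
  rw [formRoot, h, show (2 * (f.1 : ℂ)) = ((2 * f.1 : ℝ) : ℂ) by push_cast; ring,
    Complex.div_ofReal_im]
  simp

lemma formRoot_re (f : ℤ × ℤ × ℤ) : (formRoot f).re = -f.2.1 / (2 * f.1) := by
  rw [formRoot, show (2 * (f.1 : ℂ)) = ((2 * f.1 : ℝ) : ℂ) by push_cast; ring,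
    Complex.div_ofReal_re]
  simp

lemma formRoot_im_pos {d : ℤ} (hd : 0 < d) {f : ℤ × ℤ × ℤ} (hf : IsForm d f) :
    0 < (formRoot f).im := by
  rw [formRoot_im hf]
  have h1 : (0 : ℝ) < d := by exact_mod_cast hd
  have h2 : (0 : ℝ) < f.1 := by exact_mod_cast hf.1
  positivity

lemma formRoot_eval {d : ℤ} (hd : 0 < d) {f : ℤ × ℤ × ℤ} (hf : IsForm d f) :
    (f.1 : ℂ) * formRoot f ^ 2 + f.2.1 * formRoot f + f.2.2 = 0 := by
  have ha : (f.1 : ℂ) ≠ 0 := by exact_mod_cast hf.1.ne'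
  have h : 4 * f.1 * f.2.2 - f.2.1 ^ 2 = d := by linarith [hf.2]
  have hs : ((Real.sqrt d : ℝ) : ℂ) ^ 2 = 4 * f.1 * f.2.2 - f.2.1 ^ 2 := by
    rw [← Complex.ofReal_pow, Real.sq_sqrt (by exact_mod_cast hd.le), ← h]
    push_cast; ring
  rw [formRoot, h]
  field_simp
  ring_nf
  rw [Complex.I_sq, hs]
  ring

/-- The root of a form in the upper half plane is unique. -/
lemma eq_formRoot {d : ℤ} (hd : 0 < d) {f : ℤ × ℤ × ℤ} (hf : IsForm d f) {z : ℂ} (hz : 0 < z.im)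
    (h : (f.1 : ℂ) * z ^ 2 + f.2.1 * z + f.2.2 = 0) : z = formRoot f := by
  have ha : (f.1 : ℂ) ≠ 0 := by exact_mod_cast hf.1.ne'
  have hfac : (z - formRoot f) * (f.1 * (z + formRoot f) + f.2.1) = 0 := by
    linear_combination h - formRoot_eval hd hf
  rcases mul_eq_zero.mp hfac with h0 | h0
  · exact sub_eq_zero.mp h0
  · have him := congrArg Complex.im h0
    have h1 : (0 : ℝ) < f.1 := by exact_mod_cast hf.1
    have h2 := formRoot_im_pos hd hf
    simp at him
    rcases him with h3 | h3
    · exact absurd h3 hf.1.ne'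
    · linarith

lemma latticeG_moebius {p q r s : ℤ} (hdet : p * s - q * r = 1) (k : ℕ) {z w : ℂ}
    (hr : (r : ℂ) * z + s ≠ 0) (hw : w * (r * z + s) = p * z + q) :
    latticeG k w = (r * z + s) ^ k * latticeG k z := by
  let e : ℤ × ℤ ≃ ℤ × ℤ :=
    { toFun := fun v => (v.1 * p + v.2 * r, v.1 * q + v.2 * s)
      invFun := fun v => (v.1 * s - v.2 * r, v.2 * p - v.1 * q)
      left_inv := fun v => by
        ext <;> dsimp only
        · linear_combination v.1 * hdet
        · linear_combination v.2 * hdet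
      right_inv := fun v => by
        ext <;> dsimp only
        · linear_combination v.1 * hdet
        · linear_combination v.2 * hdet }
  have he : ∀ v, e v = 0 ↔ v = 0 := fun v => by
    rw [← e.apply_eq_iff_eq (x := v) (y := 0)]
    simp [e]
  rw [latticeG, latticeG, ← tsum_mul_left]
  conv_rhs => rw [← e.tsum_eq]
  refine tsum_congr fun v => ?_
  by_cases hv : v = 0
  · simp [hv, (he 0).mpr rfl]
  · rw [if_neg hv, if_neg (mt (he v).mp hv)]
    have : (v.1 : ℂ) * w + v.2 = ((e v).1 * z + (e v).2) / (r * z + s) := by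
      rw [eq_div_iff hr]
      simp only [e, Equiv.coe_fn_mk]
      push_cast
      linear_combination (v.1 : ℂ) * hw
    rw [this, div_pow, one_div_div]
    ring

lemma jInv_moebius {p q r s : ℤ} (hdet : p * s - q * r = 1) {z w : ℂ}
    (hr : (r : ℂ) * z + s ≠ 0) (hw : w * (r * z + s) = p * z + q) : jInv w = jInv z := by
  rw [jInv, jInv, latticeG_moebius hdet 4 hr hw, latticeG_moebius hdet 6 hr hw]
  generalize (r : ℂ) * z + s = D at hr
  rw [← mul_div_mul_left (1728 * (60 * latticeG 4 z) ^ 3) _ (pow_ne_zero 12 hr)]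
  congr 1 <;> ring

lemma FormRel.coeffs {f f' : ℤ × ℤ × ℤ} (h : FormRel f f') :
    ∃ p q r s : ℤ, p * s - q * r = 1 ∧ f'.1 = formVal f p r ∧ f'.2.2 = formVal f q s ∧
      f'.2.1 = 2 * f.1 * p * q + f.2.1 * (p * s + q * r) + 2 * f.2.2 * r * s := by
  obtain ⟨g, hg⟩ := h
  have hdet := g.2
  rw [Matrix.det_fin_two] at hdet
  have h10 := hg 1 0
  have h01 := hg 0 1
  have h11 := hg 1 1
  refine ⟨_, _, _, _, hdet, ?_, ?_, ?_⟩
  · simpa [formVal] using h10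
  · simpa [formVal] using h01
  · simp only [formVal] at h10 h01 h11
    linear_combination h11 - h10 - h01

lemma FormRel.jInv_eq {d : ℤ} (hd : 0 < d) {f f' : ℤ × ℤ × ℤ} (hf : IsForm d f)
    (hf' : IsForm d f') (h : FormRel f f') : jInv (formRoot f) = jInv (formRoot f') := by
  obtain ⟨p, q, r, s, hdet, ha, hc, hb⟩ := h.coeffs
  have hz := formRoot_eval hd hf'
  have him := formRoot_im_pos hd hf'
  set z := formRoot f'
  have hr : (r : ℂ) * z + s ≠ 0 := by
    intro h0
    have h1 := congrArg Complex.im h0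
    simp at h1
    rcases h1 with h1 | h1
    · subst h1
      simp at h0
      subst h0
      simp at hdet
    · exact him.ne' h1
  refine jInv_moebius hdet hr ?_
  have hroot : (p * z + q) / (r * z + s) = formRoot f := by
    refine eq_formRoot hd hf ?_ ?_
    · have hdetR : (p : ℝ) * s - q * r = 1 := by exact_mod_cast hdet
      have hn : 0 < Complex.normSq (r * z + s) := Complex.normSq_pos.mpr hr
      rw [Complex.div_im, ← sub_div]
      apply div_pos _ hn
      simp
      nlinarith
    · rw [ha, hb, hc] at hz
      simp only [formVal] at hz
      push_cast at hz
      have hzr : (p * z + q) / (r * z + s) * (r * z + s) = p * z + q := div_mul_cancel₀ _ hr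
      apply mul_left_cancel₀ (pow_ne_zero 2 hr)
      generalize ((p : ℂ) * z + q) / (r * z + s) = w at hzr ⊢
      have hw2 : w ^ 2 * (r * z + s) ^ 2 = (p * z + q) ^ 2 := by rw [← mul_pow, hzr]
      linear_combination hz + f.1 * hw2 + f.2.1 * (r * z + s) * hzr
  rw [← hroot, div_mul_cancel₀ _ hr]

/-- The form `f ∘ g`, as a function. -/
def formComp (f : ℤ × ℤ × ℤ) (g : Matrix.SpecialLinearGroup (Fin 2) ℤ) (x y : ℤ) : ℤ :=
  formVal f (g.1 0 0 * x + g.1 0 1 * y) (g.1 1 0 * x + g.1 1 1 * y)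

lemma formComp_mul (f : ℤ × ℤ × ℤ) (g h : Matrix.SpecialLinearGroup (Fin 2) ℤ) (x y : ℤ) :
    formComp f (g * h) x y =
      formComp f g (h.1 0 0 * x + h.1 0 1 * y) (h.1 1 0 * x + h.1 1 1 * y) := by
  simp only [formComp, Matrix.SpecialLinearGroup.coe_mul, Matrix.mul_apply, Fin.sum_univ_two]
  congr 1 <;> ring

lemma formComp_one (f : ℤ × ℤ × ℤ) (x y : ℤ) : formComp f 1 x y = formVal f x y := by
  simp [formComp]

lemma formComp_conj {f f' : ℤ × ℤ × ℤ} {g h : Matrix.SpecialLinearGroup (Fin 2) ℤ}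
    (hh : ∀ x y, formVal f' x y = formComp f h x y) (hg : ∀ x y, formVal f x y = formComp f g x y)
    (x y : ℤ) : formVal f' x y = formComp f' (h⁻¹ * g * h) x y := by
  have h1 : formComp f' (h⁻¹ * g * h) x y = formComp f (h * (h⁻¹ * g * h)) x y := by
    rw [formComp_mul f h, ← hh, formComp]
  rw [h1, show h * (h⁻¹ * g * h) = g * h by group, formComp_mul, ← hg, hh, formComp]

lemma FormRel.formWt_eq {f f' : ℤ × ℤ × ℤ} (h : FormRel f f') : formWt f = formWt f' := by
  obtain ⟨h, hh⟩ := h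
  have hh' : ∀ x y, formVal f x y = formComp f' h⁻¹ x y := fun x y => by
    have : formComp f (h * h⁻¹) x y = formComp f' h⁻¹ x y := by
      rw [formComp_mul]; exact (hh _ _).symm
    rw [← this, mul_inv_cancel, formComp_one]
  rw [formWt, formWt]
  congr 1
  refine Nat.card_congr (Equiv.subtypeEquiv (MulAut.conj h⁻¹).toEquiv fun g => ⟨fun hg => ?_,
    fun hg => ?_⟩)
  · intro x y
    have := formComp_conj hh hg x y
    simp only [MulEquiv.toEquiv_eq_coe, MulEquiv.coe_toEquiv, MulAut.conj_apply, inv_inv]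
    exact this
  · intro x y
    have := formComp_conj hh' hg x y
    simp only [MulEquiv.toEquiv_eq_coe, MulEquiv.coe_toEquiv, MulAut.conj_apply, inv_inv] at this
    rwa [show h * (h⁻¹ * g * h) * h⁻¹ = g by group] at this

/-- Reduction theory: each class contains a form with `|b| ≤ a ≤ c`. -/
lemma exists_reduced {d : ℤ} (hd : 0 < d) (cl : FormClass d) :
    ∃ f : { f : ℤ × ℤ × ℤ // IsForm d f },
      Quot.mk _ f = cl ∧ |f.1.2.1| ≤ f.1.1 ∧ f.1.1 ≤ f.1.2.2 := by
  let S : Set ℕ := { n | ∃ f : { f : ℤ × ℤ × ℤ // IsForm d f }, Quot.mk _ f = cl ∧ f.1.1 = n }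
  have hS : S.Nonempty := by
    obtain ⟨f, rfl⟩ := Quot.exists_rep cl
    exact ⟨f.1.1.toNat, f, rfl, (Int.toNat_of_nonneg f.2.1.le).symm⟩
  obtain ⟨⟨⟨a, b, c⟩, ha, hD⟩, hcl, hn⟩ := Nat.sInf_mem hS
  dsimp only at ha hD hn
  obtain ⟨k, hk⟩ : ∃ k : ℤ, |b + 2 * a * k| ≤ a := by
    refine ⟨-((b + a) / (2 * a)), ?_⟩
    have h1 := Int.emod_add_mul_ediv (b + a) (2 * a)
    have h2 := Int.emod_nonneg (b + a) (show 2 * a ≠ 0 by omega)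
    have h3 := Int.emod_lt_of_pos (b + a) (show 0 < 2 * a by omega)
    rw [mul_neg, abs_le]
    constructor <;> linarith
  have hform : IsForm d (a, b + 2 * a * k, a * k ^ 2 + b * k + c) :=
    ⟨ha, by linear_combination hD⟩
  have hcl' : (Quot.mk _ ⟨_, hform⟩ : FormClass d) = cl := by
    rw [← hcl]
    refine (Quot.sound ⟨⟨!![1, k; 0, 1], by simp⟩, fun x y => ?_⟩).symm
    simp [formVal]
    ring
  refine ⟨⟨_, hform⟩, hcl', hk, ?_⟩
  have hD' := hform.2
  dsimp only at hD' ⊢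
  generalize b + 2 * a * k = b' at *
  generalize a * k ^ 2 + b * k + c = c' at *
  have hc' : 0 < c' := by
    have h1 : 0 < 4 * a * c' := by nlinarith
    exact pos_of_mul_pos_right h1 (by linarith)
  have hform' : IsForm d (c', -b', a) := ⟨hc', by linear_combination hD'⟩
  have hmem : c'.toNat ∈ S := by
    refine ⟨⟨_, hform'⟩, ?_, (Int.toNat_of_nonneg hc'.le).symm⟩
    rw [← hcl']
    refine (Quot.sound ⟨⟨!![0, -1; 1, 0], by simp⟩, fun x y => ?_⟩).symm
    simp [formVal]
    ring
  have := Nat.sInf_le hmem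
  omega

lemma three_mul_sq_le {d : ℤ} {f : ℤ × ℤ × ℤ} (hf : IsForm d f) (hb : |f.2.1| ≤ f.1)
    (hc : f.1 ≤ f.2.2) : 3 * f.1 ^ 2 ≤ d := by
  have h1 := hf.1
  have h2 := hf.2
  have h3 : f.2.1 ^ 2 ≤ f.1 ^ 2 := sq_le_sq' (abs_le.mp hb).1 (abs_le.mp hb).2
  nlinarith

lemma odd_middle {d : ℤ} (hmod : d % 4 = 3) {f : ℤ × ℤ × ℤ} (hf : IsForm d f) :
    f.2.1 % 2 = 1 := by
  by_contra h
  obtain ⟨k, hk⟩ : ∃ k, f.2.1 = 2 * k := ⟨f.2.1 / 2, by omega⟩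
  have h2 := hf.2
  rw [hk] at h2
  have : d = 4 * (f.1 * f.2.2 - k ^ 2) := by linarith
  omega

lemma exists_finset_reduced (d : ℤ) (hd : 0 < d) :
    ∃ s : ℕ, 3 * (s : ℤ) ^ 2 ≤ d ∧ ∀ a : ℤ, 0 < a → 3 * a ^ 2 ≤ d → a ≤ s := by
  refine ⟨Nat.sqrt (d / 3).toNat, ?_, fun a ha h => ?_⟩
  · have h1 := Nat.sqrt_le' (d / 3).toNat
    zify at h1
    rw [Int.toNat_of_nonneg (by omega)] at h1
    omega
  · have h1 : a.toNat ≤ Nat.sqrt (d / 3).toNat := by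
      rw [Nat.le_sqrt']
      zify
      rw [Int.toNat_of_nonneg (by omega), Int.toNat_of_nonneg (by omega)]
      omega
    omega

/-- There are finitely many classes of discriminant `-d`, at most `d` of them. -/
lemma finite_formClass {d : ℤ} (hd : 0 < d) :
    Finite (FormClass d) ∧ (Nat.card (FormClass d) : ℤ) ≤ d := by
  obtain ⟨s, hs, hs'⟩ := exists_finset_reduced d hd
  choose r hr hb hc using exists_reduced hd
  have hmem (cl : FormClass d) :
      ((r cl).1.1, (r cl).1.2.1) ∈ Finset.Icc (1 : ℤ) s ×ˢ Finset.Icc (-s : ℤ) s := by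
    have h1 := (r cl).2.1
    have h2 := hs' _ h1 (three_mul_sq_le (r cl).2 (hb cl) (hc cl))
    have h3 := abs_le.mp (hb cl)
    simp only [Finset.mem_product, Finset.mem_Icc]
    omega
  let φ : FormClass d → (Finset.Icc (1 : ℤ) s ×ˢ Finset.Icc (-s : ℤ) s : Finset (ℤ × ℤ)) :=
    fun cl => ⟨_, hmem cl⟩
  have hφ : Function.Injective φ := by
    intro cl cl' h
    have h' := congrArg Subtype.val h
    simp only [φ, Prod.mk.injEq] at h'
    obtain ⟨ha, hb'⟩ := h'
    rw [← hr cl, ← hr cl']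
    congr 1
    ext1
    refine Prod.ext ha (Prod.ext hb' ?_)
    have e1 := (r cl).2.2
    have e2 := (r cl').2.2
    rw [ha, hb'] at e1
    have h1 := (r cl').2.1
    apply mul_left_cancel₀ (show 4 * (r cl').1.1 ≠ 0 by omega)
    linarith
  have : Finite (FormClass d) := Finite.of_injective φ hφ
  refine ⟨this, ?_⟩
  have hcard := Nat.card_le_card_of_injective φ hφ
  rw [Nat.card_eq_finsetCard, Finset.card_product, Int.card_Icc,
    Int.card_Icc] at hcard
  have e1 : ((s : ℤ) + 1 - 1).toNat = s := by omega
  have e2 : ((s : ℤ) + 1 - -s).toNat = 2 * s + 1 := by omega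
  rw [e1, e2] at hcard
  zify at hcard
  nlinarith [mul_self_nonneg ((s : ℤ) - 1), Int.le_self_sq (s : ℤ)]

/-- The summand of the trace attached to a form. -/
noncomputable def traceTerm (f : ℤ × ℤ × ℤ) : ℂ :=
  (jInv (formRoot f) - 744) / (formWt f : ℂ)

lemma traceTerm_out {d : ℤ} (hd : 0 < d) (f : { f : ℤ × ℤ × ℤ // IsForm d f }) :
    traceTerm (Quot.out (Quot.mk _ f : FormClass d)).1 = traceTerm f.1 :=
  congrArg (Quot.lift (fun f : { f : ℤ × ℤ × ℤ // IsForm d f } => traceTerm f.1)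
    fun f f' h => by
      rw [traceTerm, traceTerm, h.jInv_eq hd f.2 f'.2, h.formWt_eq]) (Quot.out_eq (Quot.mk _ f))

lemma re_one_div_qParam {d : ℤ} {f : ℤ × ℤ × ℤ} (hf : IsForm d f) :
    (1 / Complex.exp (2 * Real.pi * Complex.I * formRoot f)).re =
      Real.exp (Real.pi * Real.sqrt d / f.1) * Real.cos (Real.pi * f.2.1 / f.1) := by
  have ha : (f.1 : ℝ) ≠ 0 := by exact_mod_cast hf.1.ne'
  have hre : (-(2 * Real.pi * Complex.I * formRoot f)).re = Real.pi * Real.sqrt d / f.1 := by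
    simp [formRoot_im hf]
    field_simp
  have him : (-(2 * Real.pi * Complex.I * formRoot f)).im = Real.pi * f.2.1 / f.1 := by
    simp [formRoot_re f]
    field_simp
  rw [one_div, ← Complex.exp_neg, Complex.exp_re, hre, him]

lemma abs_re_jInv_sub_le {d : ℤ} {f : ℤ × ℤ × ℤ} (hf : IsForm d f) (h3 : 3 * f.1 ^ 2 ≤ d) :
    |(jInv (formRoot f) - 744).re -
      Real.exp (Real.pi * Real.sqrt d / f.1) * Real.cos (Real.pi * f.2.1 / f.1)| ≤ 1500 := by
  rw [← re_one_div_qParam hf, ← Complex.sub_re]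
  refine (Complex.abs_re_le_norm _).trans (norm_jInv_sub_le ?_)
  have ha : (0 : ℝ) < f.1 := by exact_mod_cast hf.1
  rw [formRoot_im hf, div_le_div_iff₀ (by norm_num) (by positivity)]
  have h : Real.sqrt 3 * f.1 ≤ Real.sqrt d := by
    apply Real.le_sqrt_of_sq_le
    rw [mul_pow, Real.sq_sqrt (by norm_num)]
    exact_mod_cast h3
  linarith

lemma traceTerm_re (f : ℤ × ℤ × ℤ) :
    (traceTerm f).re = (jInv (formRoot f) - 744).re / formWt f := by
  rw [traceTerm, Complex.div_natCast_re]

/-- Nonprincipal reduced forms contribute at most `exp(π√d/3)`, up to a constant; for `a = 2`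
the main term is purely imaginary. -/
lemma abs_traceTerm_re_le {d : ℤ} (hmod : d % 4 = 3) {f : ℤ × ℤ × ℤ} (hf : IsForm d f)
    (hb : |f.2.1| ≤ f.1) (hc : f.1 ≤ f.2.2) (ha : f.1 ≠ 1) :
    |(traceTerm f).re| ≤ Real.exp (Real.pi / 3 * Real.sqrt d) + 1500 := by
  have hpos := hf.1
  have hodd := odd_middle hmod hf
  have h := abs_re_jInv_sub_le hf (three_mul_sq_le hf hb hc)
  have hmain : |Real.exp (Real.pi * Real.sqrt d / f.1) * Real.cos (Real.pi * f.2.1 / f.1)| ≤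
      Real.exp (Real.pi / 3 * Real.sqrt d) := by
    by_cases h2 : f.1 = 2
    · have hcos : Real.cos (Real.pi * f.2.1 / f.1) = 0 := by
        rw [h2] at hb ⊢
        have hb' := abs_le.mp hb
        have : f.2.1 = 1 ∨ f.2.1 = -1 := by omega
        rcases this with h | h <;> rw [h]
        · simp
        · rw [show Real.pi * ((-1 : ℤ) : ℝ) / ((2 : ℤ) : ℝ) = -(Real.pi / 2) by push_cast; ring,
            Real.cos_neg, Real.cos_pi_div_two]
      rw [hcos, mul_zero, abs_zero]
      positivity
    · have h3 : (3 : ℝ) ≤ f.1 := by exact_mod_cast (show (3 : ℤ) ≤ f.1 by omega)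
      rw [abs_mul, Real.abs_exp]
      refine (mul_le_of_le_one_right (Real.exp_pos _).le (Real.abs_cos_le_one _)).trans ?_
      rw [Real.exp_le_exp, div_mul_eq_mul_div]
      gcongr
  have hj : |(jInv (formRoot f) - 744).re| ≤ Real.exp (Real.pi / 3 * Real.sqrt d) + 1500 := by
    rw [abs_le] at *
    constructor <;> linarith
  rw [traceTerm_re, abs_div, Nat.abs_cast]
  rcases Nat.eq_zero_or_pos (formWt f) with hw | hw
  · rw [hw, Nat.cast_zero, div_zero]
    positivity
  · exact (div_le_self (abs_nonneg _) (by exact_mod_cast hw)).trans hj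

lemma formWt_principal {c : ℤ} (hc : 2 ≤ c) : formWt (1, 1, c) = 1 := by
  rw [formWt]
  suffices h : Nat.card { g : Matrix.SpecialLinearGroup (Fin 2) ℤ //
      ∀ x y : ℤ, formVal (1, 1, c) x y =
        formVal (1, 1, c) (g.1 0 0 * x + g.1 0 1 * y) (g.1 1 0 * x + g.1 1 1 * y) } = 2 by
    rw [h]
  rw [Nat.card_eq_two_iff]
  refine ⟨⟨1, by simp⟩, ⟨-1, by simp [formVal]⟩, ?_, ?_⟩
  · intro h
    have := congrArg (fun g => g.1.1 0 0) h
    simp at this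
  · rw [Set.eq_univ_iff_forall]
    rintro ⟨g, hg⟩
    have hdet := g.2
    rw [Matrix.det_fin_two] at hdet
    have h10 := hg 1 0
    have h01 := hg 0 1
    have h11 := hg 1 1
    have key : (g.1 0 0 = 1 ∧ g.1 0 1 = 0 ∧ g.1 1 0 = 0 ∧ g.1 1 1 = 1) ∨
        (g.1 0 0 = -1 ∧ g.1 0 1 = 0 ∧ g.1 1 0 = 0 ∧ g.1 1 1 = -1) := by
      generalize g.1 0 0 = p at *
      generalize g.1 0 1 = q at *
      generalize g.1 1 0 = r at *
      generalize g.1 1 1 = s at *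
      simp only [formVal] at h10 h01 h11
      have hr : r = 0 := by
        by_contra hr
        have : 0 < r ^ 2 := by positivity
        nlinarith [sq_nonneg (2 * p + r)]
      subst hr
      have hps : p * s = 1 := by linarith
      have hq : q = 0 := by
        have : p * q = 0 := by linarith
        rcases mul_eq_zero.mp this with h | h
        · simp [h] at hps
        · exact h
      rcases Int.eq_one_or_neg_one_of_mul_eq_one hps with h | h
      · left; subst h; omega
      · right; subst h; omega
    simp only [Set.mem_insert_iff, Set.mem_singleton_iff, Subtype.mk.injEq]
    rcases key with ⟨h1, h2, h3, h4⟩ | ⟨h1, h2, h3, h4⟩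
    · left; ext i j; fin_cases i <;> fin_cases j <;> simp [h1, h2, h3, h4]
    · right; ext i j; fin_cases i <;> fin_cases j <;> simp [h1, h2, h3, h4]

lemma formWt_hexagonal : formWt (1, 1, 1) = 0 ∨ 2 ≤ formWt (1, 1, 1) := by
  rw [formWt]
  set T := { g : Matrix.SpecialLinearGroup (Fin 2) ℤ //
      ∀ x y : ℤ, formVal (1, 1, 1) x y =
        formVal (1, 1, 1) (g.1 0 0 * x + g.1 0 1 * y) (g.1 1 0 * x + g.1 1 1 * y) }
  rcases finite_or_infinite T with hT | hT
  · right
    let e : Fin 4 → T := ![⟨1, by simp⟩, ⟨-1, by simp [formVal]⟩,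
      ⟨⟨!![0, -1; 1, 1], by simp⟩, by intro x y; simp [formVal]; ring⟩,
      ⟨⟨!![0, 1; -1, -1], by simp⟩, by intro x y; simp [formVal]; ring⟩]
    have he : Function.Injective e := by
      have : Function.Injective ((fun g : T => (g.1.1 0 0, g.1.1 1 0)) ∘ e) := by
        have h : ((fun g : T => (g.1.1 0 0, g.1.1 1 0)) ∘ e) =
            ![(1, 0), (-1, 0), (0, 1), (0, -1)] := by
          ext i <;> fin_cases i <;> simp [e]
        rw [h]
        decide
      exact this.of_comp
    have := Nat.card_le_card_of_injective e he
    rw [Nat.card_fin] at this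
    omega
  · left
    simp

lemma jInv_hexagonal : jInv (formRoot (1, 1, 1)) = 0 := by
  have hω := formRoot_eval (d := 3) (by norm_num) (f := (1, 1, 1)) ⟨by norm_num, by norm_num⟩
  set ω := formRoot (1, 1, 1)
  simp only [Int.cast_one, one_mul] at hω
  have hne : ((1 : ℤ) : ℂ) * ω + (1 : ℤ) ≠ 0 := by
    intro h
    push_cast at h
    have : (1 : ℂ) = 0 := by linear_combination hω - ω * h
    exact one_ne_zero this
  have h := latticeG_moebius (p := 0) (q := -1) (r := 1) (s := 1) (by norm_num) 4 hne
    (w := ω) (by push_cast; linear_combination hω)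
  push_cast at h
  have h0 : (ω + 2) * latticeG 4 ω = 0 := by
    linear_combination h + (ω ^ 2 + 3 * ω + 2) * latticeG 4 ω * hω
  have h2 : ω + 2 ≠ 0 := by
    intro h2
    have : (3 : ℂ) = 0 := by linear_combination hω - (ω - 1) * h2
    norm_num at this
  rw [jInv, (mul_eq_zero.mp h0).resolve_left h2]
  simp

lemma isForm_principal {d : ℤ} (hmod : d % 4 = 3) : IsForm d (1, 1, (1 + d) / 4) :=
  ⟨one_pos, by dsimp only; omega⟩

/-- The class of the form `x² + xy + ((1 + d)/4)y²`. -/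
def principalClass {d : ℤ} (hmod : d % 4 = 3) : FormClass d := Quot.mk _ ⟨_, isForm_principal hmod⟩

lemma eq_principalClass {d : ℤ} (hmod : d % 4 = 3) (f : { f : ℤ × ℤ × ℤ // IsForm d f })
    (hb : |f.1.2.1| ≤ f.1.1) (ha : f.1.1 = 1) : Quot.mk _ f = principalClass hmod := by
  obtain ⟨⟨a, b, c⟩, hf⟩ := f
  have hodd := odd_middle hmod hf
  have hD := hf.2
  dsimp only at *
  subst ha
  have hb' := abs_le.mp hb
  have hb1 : b = 1 ∨ b = -1 := by omega
  rcases hb1 with rfl | rfl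
  · have : c = (1 + d) / 4 := by omega
    subst this
    rfl
  · refine Quot.sound ⟨⟨!![1, 1; 0, 1], by simp⟩, fun x y => ?_⟩
    have : (1 + d) / 4 = c := by omega
    simp [formVal, this]
    ring

lemma traceTerm_principalClass {d : ℤ} (hd : 0 < d) (hmod : d % 4 = 3) :
    traceTerm (Quot.out (principalClass hmod)).1 = traceTerm (1, 1, (1 + d) / 4) :=
  traceTerm_out hd ⟨_, isForm_principal hmod⟩

lemma abs_traceTerm_principal_le {d : ℤ} (hmod : d % 4 = 3) (hd : 7 ≤ d) :
    |(traceTerm (1, 1, (1 + d) / 4)).re + Real.exp (Real.pi * Real.sqrt d)| ≤ 1500 := by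
  have h := abs_re_jInv_sub_le (isForm_principal hmod) (by dsimp only; omega)
  rw [traceTerm_re, formWt_principal (by omega)]
  simpa using h

lemma abs_traceTerm_out_le {d : ℤ} (hd : 0 < d) (hmod : d % 4 = 3) (cl : FormClass d)
    (hcl : cl ≠ principalClass hmod) :
    |(traceTerm (Quot.out cl).1).re| ≤ Real.exp (Real.pi / 3 * Real.sqrt d) + 1500 := by
  obtain ⟨f, rfl, hb, hc⟩ := exists_reduced hd cl
  rw [traceTerm_out hd]
  exact abs_traceTerm_re_le hmod f.2 hb hc fun ha => hcl (eq_principalClass hmod f hb ha)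

lemma formClass_eq_principalClass {d : ℤ} (hd : 0 < d) (hmod : d % 4 = 3) (hd12 : d < 12)
    (cl : FormClass d) : cl = principalClass hmod := by
  obtain ⟨f, rfl, hb, hc⟩ := exists_reduced hd cl
  have h1 := three_mul_sq_le f.2 hb hc
  have h2 := f.2.1
  exact eq_principalClass hmod f hb (by nlinarith)

lemma traceSM_eq_finsum {d : ℤ} (hd : 0 < d) (hmod : d % 4 = 3) :
    traceSM d = (∑ᶠ cl : FormClass d, traceTerm (Quot.out cl).1).re := by
  rw [traceSM, if_neg (by omega), if_neg (by omega), if_neg (by omega)]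
  rfl

lemma traceSM_of_lt_twelve {d : ℤ} (hd : 0 < d) (hmod : d % 4 = 3) (hd12 : d < 12) :
    traceSM d = (traceTerm (1, 1, (1 + d) / 4)).re := by
  rw [traceSM_eq_finsum hd hmod, finsum_eq_single _ (principalClass hmod)
    fun cl hcl => absurd (formClass_eq_principalClass hd hmod hd12 cl) hcl,
    traceTerm_principalClass hd]

lemma abs_traceSM_add_exp_le {d : ℤ} (hmod : d % 4 = 3) (hd : 7 ≤ d) :
    |traceSM d + Real.exp (Real.pi * Real.sqrt d)| ≤
      d * (Real.exp (Real.pi / 3 * Real.sqrt d) + 1500) := by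
  have hd0 : 0 < d := by omega
  obtain ⟨hfin, hcard⟩ := finite_formClass hd0
  classical
  have := Fintype.ofFinite (FormClass d)
  set E := Real.exp (Real.pi / 3 * Real.sqrt d)
  have hE : 0 < E := Real.exp_pos _
  rw [traceSM_eq_finsum hd0 hmod, finsum_eq_sum_of_fintype, Complex.re_sum,
    ← Finset.add_sum_erase _ _ (Finset.mem_univ (principalClass hmod)),
    traceTerm_principalClass hd0, add_right_comm]
  refine (abs_add_le _ _).trans ?_
  have h1 := abs_traceTerm_principal_le hmod hd
  have h2 : |∑ cl ∈ Finset.univ.erase (principalClass hmod), (traceTerm (Quot.out cl).1).re| ≤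
      (Finset.univ.erase (principalClass hmod)).card • (E + 1500) :=
    (Finset.abs_sum_le_sum_abs _ _).trans (Finset.sum_le_card_nsmul _ _ _ fun cl hcl =>
      abs_traceTerm_out_le hd0 hmod cl (Finset.ne_of_mem_erase hcl))
  have hN : ((Finset.univ.erase (principalClass hmod)).card : ℝ) + 1 ≤ d := by
    have h := Finset.card_erase_add_one (Finset.mem_univ (principalClass hmod))
    rw [Finset.card_univ, ← Nat.card_eq_fintype_card] at h
    zify at h
    rw [← h] at hcard
    exact_mod_cast hcard
  rw [nsmul_eq_mul] at h2
  nlinarith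

lemma const_lower_bound {x y : ℝ} (h : y ^ 2 ≤ x) :
    x * y ≤ x ^ ((3 : ℝ) / 2) := by
  have hx : 0 ≤ x := (sq_nonneg y).trans h
  have hs : x ^ ((3 : ℝ) / 2) = x * Real.sqrt x := by
    rw [Real.sqrt_eq_rpow, show (3 : ℝ) / 2 = 1 + 1 / 2 by norm_num,
      Real.rpow_add_of_nonneg hx (by norm_num) (by norm_num), Real.rpow_one]
  rw [hs]
  exact mul_le_mul_of_nonneg_left (Real.le_sqrt_of_sq_le h) hx

lemma exp_one_pow_mul_le {t u : ℝ} (n : ℕ) (hu : 0 ≤ u) (h : n + u ≤ t) :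
    2.718 ^ n * (1 + u + u ^ 2 / 2) ≤ Real.exp t := by
  have h1 := Real.exp_one_gt_d9
  calc (2.718 : ℝ) ^ n * (1 + u + u ^ 2 / 2) ≤ Real.exp 1 ^ n * Real.exp u := by
        gcongr
        · linarith
        · exact Real.quadratic_le_exp_of_nonneg hu
    _ = Real.exp (n + u) := by rw [← Real.exp_nat_mul, mul_one, Real.exp_add]
    _ ≤ _ := Real.exp_le_exp.mpr h

lemma traceSM_three :
    |traceSM 3 + Real.exp (Real.pi * Real.sqrt 3)| ≤
      (1 / 2) * (2 * Real.pi * 3) ^ ((3 : ℝ) / 2) * Real.exp (Real.pi / 3 * Real.sqrt 3) := by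
  have hπ := Real.pi_gt_d4
  have hπ' := Real.pi_lt_d4
  have h3 : 1.732 ≤ Real.sqrt 3 := Real.le_sqrt_of_sq_le (by norm_num)
  have h3' : Real.sqrt 3 ≤ 1.7321 := Real.sqrt_le_iff.mpr (by norm_num)
  have hlow : 5.8 ≤ Real.exp (Real.pi / 3 * Real.sqrt 3) := by
    refine le_trans ?_ (exp_one_pow_mul_le (u := 0.81) 1 (by norm_num) ?_)
    · norm_num
    · push_cast; nlinarith
  have hup : Real.exp (Real.pi / 3 * Real.sqrt 3) ≤ 6.39 := by
    have h1 := Real.exp_one_lt_d9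
    have h16 : Real.exp (0.814 / 16) ≤ 1.0537 := by
      have h := Real.one_sub_le_exp_neg (0.814 / 16)
      rw [Real.exp_neg] at h
      rw [← inv_inv (Real.exp (0.814 / 16))]
      refine (inv_anti₀ (by norm_num) h).trans (by norm_num)
    calc Real.exp (Real.pi / 3 * Real.sqrt 3) ≤ Real.exp (1 + (16 : ℕ) * (0.814 / 16)) := by
          rw [Real.exp_le_exp]
          push_cast
          nlinarith
      _ = Real.exp 1 * Real.exp (0.814 / 16) ^ 16 := by rw [Real.exp_add, Real.exp_nat_mul]
      _ ≤ 2.7183 * 1.0537 ^ 16 := by gcongr; linarith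
      _ ≤ 6.39 := by norm_num
  have hcube : Real.exp (Real.pi * Real.sqrt 3) = Real.exp (Real.pi / 3 * Real.sqrt 3) ^ 3 := by
    rw [← Real.exp_nat_mul]; congr 1; push_cast; ring
  have hconst : 81.7 ≤ (2 * Real.pi * 3) ^ ((3 : ℝ) / 2) :=
    le_trans (by linarith) (const_lower_bound (y := 4.34) (by linarith))
  have ht : traceSM 3 ≤ 0 ∧ -372 ≤ traceSM 3 := by
    have h := traceSM_of_lt_twelve (d := 3) (by norm_num) (by norm_num) (by norm_num)
    norm_num [traceTerm_re, jInv_hexagonal] at h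
    rw [h]
    rcases formWt_hexagonal with hw | hw
    · simp [hw]
    · have hw' : (2 : ℝ) ≤ formWt (1, 1, 1) := by exact_mod_cast hw
      constructor
      · exact div_nonpos_of_nonpos_of_nonneg (by norm_num) (by linarith)
      · rw [le_div_iff₀ (by linarith)]; linarith
  rw [hcube]
  generalize Real.exp (Real.pi / 3 * Real.sqrt 3) = E at *
  have hK : 40.85 * E ≤ (1 / 2) * (2 * Real.pi * 3) ^ ((3 : ℝ) / 2) * E := by
    gcongr; linarith
  refine le_trans ?_ hK
  have hE2 : E ^ 2 ≤ 6.39 ^ 2 := by gcongr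
  have hE3 : 5.8 ^ 3 ≤ E ^ 3 := by gcongr
  have hE4 : E ^ 3 ≤ 6.39 ^ 2 * E := by
    rw [pow_succ]; gcongr
  rw [abs_le]
  constructor <;> linarith [ht.1, ht.2]

lemma traceSM_of_seven_le {d : ℤ} (hmod : d % 4 = 3) (hd : 7 ≤ d) :
    |traceSM d + Real.exp (Real.pi * Real.sqrt d)| ≤
      (1 / 2) * (2 * Real.pi * d) ^ ((3 : ℝ) / 2) * Real.exp (Real.pi / 3 * Real.sqrt d) := by
  have hπ := Real.pi_gt_d4
  have hdR : (7 : ℝ) ≤ d := by exact_mod_cast hd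
  rcases lt_or_ge d 12 with h12 | h12
  · rw [traceSM_of_lt_twelve (by omega) hmod h12]
    refine (abs_traceTerm_principal_le hmod hd).trans ?_
    have hs : 2.645 ≤ Real.sqrt d := Real.le_sqrt_of_sq_le (by linarith)
    have hE : 15 ≤ Real.exp (Real.pi / 3 * Real.sqrt d) := by
      refine le_trans ?_ (exp_one_pow_mul_le (u := 0.76) 2 (by norm_num) ?_)
      · norm_num
      · push_cast; nlinarith
    have hconst : 280 ≤ (2 * Real.pi * d) ^ ((3 : ℝ) / 2) :=
      le_trans (by nlinarith) (const_lower_bound (y := 6.6) (by nlinarith))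
    calc (1500 : ℝ) ≤ 1 / 2 * 280 * 15 := by norm_num
      _ ≤ _ := by gcongr
  · have hd15 : (15 : ℝ) ≤ d := by exact_mod_cast (show 15 ≤ d by omega)
    refine (abs_traceSM_add_exp_le hmod hd).trans ?_
    have hs : 3.872 ≤ Real.sqrt d := Real.le_sqrt_of_sq_le (by linarith)
    have hE : 57 ≤ Real.exp (Real.pi / 3 * Real.sqrt d) := by
      refine le_trans ?_ (exp_one_pow_mul_le (u := 0.054) 4 (by norm_num) ?_)
      · norm_num
      · push_cast; nlinarith
    have hconst : 60 * d ≤ (2 * Real.pi * d) ^ ((3 : ℝ) / 2) :=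
      le_trans (by nlinarith) (const_lower_bound (y := 9.7) (by nlinarith))
    calc d * (Real.exp (Real.pi / 3 * Real.sqrt d) + 1500)
        ≤ d * (30 * Real.exp (Real.pi / 3 * Real.sqrt d)) := by gcongr; linarith
      _ = 1 / 2 * (60 * d) * Real.exp (Real.pi / 3 * Real.sqrt d) := by ring
      _ ≤ _ := by gcongr

open Real in
/-- Bounds of Choi–Kim–Lim for `t(d)` with `d ≡ 3 (mod 4)`:
`−exp(π√d) − (1/2)(2πd)^{3/2} exp((π/3)√d) ≤ t(d) ≤ (1/2)(2πd)^{3/2} exp((π/3)√d) − exp(π√d)`. -/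
theorem trace_bounds_three_mod_four (d : ℤ) (hd : 0 < d) (hmod : d % 4 = 3) :
    -Real.exp (π * Real.sqrt d) -
        (1 / 2) * (2 * π * d) ^ ((3 : ℝ) / 2) * Real.exp (π / 3 * Real.sqrt d) ≤ traceSM d ∧
      traceSM d ≤
        (1 / 2) * (2 * π * d) ^ ((3 : ℝ) / 2) * Real.exp (π / 3 * Real.sqrt d) -
          Real.exp (π * Real.sqrt d) := by
  have h : |traceSM d + Real.exp (π * Real.sqrt d)| ≤
      (1 / 2) * (2 * π * d) ^ ((3 : ℝ) / 2) * Real.exp (π / 3 * Real.sqrt d) := by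
    rcases lt_or_ge d 7 with h7 | h7
    · obtain rfl : d = 3 := by omega
      exact_mod_cast traceSM_three
    · exact traceSM_of_seven_le hmod h7
  rw [abs_le] at h
  constructor <;> linarith [h.1, h.2]
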